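/- Let λ ∈ ℝⁿ satisfy λ_1 ≥ λ_2 ≥ ⋯ ≥ λ_n ≥ 0. For w ∈ ℝⁿ let x_λ(w) denote the unique minimizer of x ↦ ½‖x − w‖² + ⟨λ, x⟩ over the cone K = {x : x_1 ≥ ⋯ ≥ x_n ≥ 0}, and let Prox(y) denote the unique minimizer of x ↦ ½‖x − y‖² + κ_λ(x) over ℝⁿ. Then for every y ∈ ℝⁿ there exists δ > 0 such that for all y' with ‖y' − y‖ < δ and every signed permutation matrix π with πy' = |y'|^↓, setting Γ = {i ∈ {1,…,n} : (B x_λ(πy'))_i = 0} and P = Iₙ − B_Γᵀ (B_Γ B_Γᵀ)⁻¹ B_Γ (with P = Iₙ when Γ is empty), one has Prox(y') − Prox(y) = πᵀ P π (y' − y). -/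

import Mathlib

open Matrix

/-- `absDown x` is the vector of the absolute values of the entries of `x`
arranged in non-increasing order, i.e. `|x|^↓`. -/
noncomputable def absDown {n : ℕ} (x : Fin n → ℝ) : Fin n → ℝ :=
  fun i => |x (Tuple.sort (fun k => -|x k|) i)|

/-- The decreasing weighted sorted ℓ₁ (DWSL1) function `κ_λ(x) = ∑ λ_i |x|_i^↓`. -/
noncomputable def kappa {n : ℕ} (lam x : Fin n → ℝ) : ℝ :=
  ∑ i, lam i * absDown x i

/-- A signed permutation matrix: exactly one nonzero entry in each row and
each column, and every entry is `0`, `1` or `-1`. -/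
def IsSignedPerm {n : ℕ} (π : Matrix (Fin n) (Fin n) ℝ) : Prop :=
  (∀ i, ∃! j, π i j ≠ 0) ∧ (∀ j, ∃! i, π i j ≠ 0) ∧
    ∀ i j, π i j = 0 ∨ π i j = 1 ∨ π i j = -1

/-- The matrix `B` with `(Bx)_i = x_i - x_{i+1}` for `i < n-1` and `(Bx)_{n-1} = x_{n-1}`. -/
def Bmat (n : ℕ) : Matrix (Fin n) (Fin n) ℝ :=
  Matrix.of fun i j => if j = i then 1 else if (j : ℕ) = (i : ℕ) + 1 then -1 else 0

/-- `B_Γ`: the submatrix of `B` consisting of the rows indexed by `Γ`. -/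
def Brows {n : ℕ} (Γ : Finset (Fin n)) : Matrix {i // i ∈ Γ} (Fin n) ℝ :=
  Matrix.of fun i j => Bmat n i.1 j

/-- `P = Iₙ - B_Γᵀ (B_Γ B_Γᵀ)⁻¹ B_Γ`. -/
noncomputable def Pmat {n : ℕ} (Γ : Finset (Fin n)) : Matrix (Fin n) (Fin n) ℝ :=
  1 - (Brows Γ)ᵀ * (Brows Γ * (Brows Γ)ᵀ)⁻¹ * Brows Γ

/-- The Euclidean norm on `Fin n → ℝ`. -/
noncomputable def eucNorm {n : ℕ} (x : Fin n → ℝ) : ℝ := Real.sqrt (∑ i, (x i) ^ 2)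

/-- Membership in the set `C_λ = {z : ∑_{j ≤ i} |z|_j^↓ ≤ ∑_{j ≤ i} λ_j for all i}`. -/
def memC {n : ℕ} (lam z : Fin n → ℝ) : Prop :=
  ∀ i : Fin n, ∑ j ∈ Finset.Iic i, absDown z j ≤ ∑ j ∈ Finset.Iic i, lam j

/-! ### The monotone nonnegative cone and `absDown` -/

/-- The cone `K = {x : x_1 ≥ ⋯ ≥ x_n ≥ 0}`. -/
def monoCone (n : ℕ) : Set (Fin n → ℝ) := {x | Antitone x ∧ ∀ i, 0 ≤ x i}

theorem isClosed_monoCone (n : ℕ) : IsClosed (monoCone n) := by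
  have h : monoCone n = (⋂ (i : Fin n) (j : Fin n) (_ : i ≤ j), {x | x j ≤ x i}) ∩
      ⋂ i : Fin n, {x | 0 ≤ x i} := by
    ext x
    simp [monoCone, Antitone]
  rw [h]
  refine IsClosed.inter ?_ ?_
  · exact isClosed_iInter fun i => isClosed_iInter fun j => isClosed_iInter fun _ =>
      isClosed_le (continuous_apply j) (continuous_apply i)
  · exact isClosed_iInter fun i => isClosed_le continuous_const (continuous_apply i)

theorem convex_monoCone (n : ℕ) : Convex ℝ (monoCone n) := by
  intro x hx y hy a b ha hb _
  refine ⟨fun i j hij => ?_, fun i => ?_⟩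
  · have h1 := mul_le_mul_of_nonneg_left (hx.1 hij) ha
    have h2 := mul_le_mul_of_nonneg_left (hy.1 hij) hb
    simpa using add_le_add h1 h2
  · have h1 := mul_nonneg ha (hx.2 i)
    have h2 := mul_nonneg hb (hy.2 i)
    simpa using add_nonneg h1 h2

theorem absDown_mem_monoCone {n : ℕ} (x : Fin n → ℝ) : absDown x ∈ monoCone n := by
  refine ⟨fun i j hij => ?_, fun i => abs_nonneg _⟩
  have h := Tuple.monotone_sort (fun k => -|x k|) hij
  simpa [absDown] using h

theorem absDown_eq_of_antitone {n : ℕ} (x : Fin n → ℝ) (σ : Equiv.Perm (Fin n))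
    (h : Antitone fun i => |x (σ i)|) : absDown x = fun i => |x (σ i)| := by
  have h1 : Monotone ((fun k => -|x k|) ∘ σ) := fun i j hij => neg_le_neg (h hij)
  have h2 := Tuple.unique_monotone (Tuple.monotone_sort fun k => -|x k|) h1
  funext i
  simpa [absDown] using congrFun h2 i

theorem absDown_of_mem {n : ℕ} {x : Fin n → ℝ} (hx : x ∈ monoCone n) : absDown x = x := by
  have h : (fun i => |x i|) = x := funext fun i => abs_of_nonneg (hx.2 i)
  have := absDown_eq_of_antitone x 1 (by simpa [h] using hx.1)
  simpa [h] using this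

theorem kappa_of_mem {n : ℕ} (lam : Fin n → ℝ) {x : Fin n → ℝ} (hx : x ∈ monoCone n) :
    kappa lam x = ∑ i, lam i * x i := by
  rw [kappa, absDown_of_mem hx]

theorem sum_absDown_sq {n : ℕ} (x : Fin n → ℝ) : ∑ i, absDown x i ^ 2 = ∑ i, x i ^ 2 := by
  simp only [absDown, sq_abs]
  exact Equiv.sum_comp (Tuple.sort fun k => -|x k|) fun i => x i ^ 2

/-- Rearrangement inequality for `κ_λ`. -/
theorem sum_mul_abs_perm_le_kappa {n : ℕ} {lam : Fin n → ℝ} (hmono : Antitone lam)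
    (x : Fin n → ℝ) (σ : Equiv.Perm (Fin n)) :
    ∑ i, lam i * |x (σ i)| ≤ kappa lam x := by
  have hv : Monovary lam (absDown x) := hmono.monovary (absDown_mem_monoCone x).1
  have h := hv.sum_mul_comp_perm_le_sum_mul
    (σ := σ.trans (Tuple.sort fun k => -|x k|).symm)
  simpa [absDown, kappa] using h

theorem kappa_midpoint_le {n : ℕ} {lam : Fin n → ℝ} (hmono : Antitone lam)
    (hpos : ∀ i, 0 ≤ lam i) (x y : Fin n → ℝ) :
    kappa lam (fun i => (x i + y i) / 2) ≤ (kappa lam x + kappa lam y) / 2 := by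
  set σ := Tuple.sort fun k => -|(x k + y k) / 2|
  have hx := sum_mul_abs_perm_le_kappa hmono x σ
  have hy := sum_mul_abs_perm_le_kappa hmono y σ
  have h : kappa lam (fun i => (x i + y i) / 2) ≤
      ∑ i, (lam i * |x (σ i)| + lam i * |y (σ i)|) / 2 := by
    refine Finset.sum_le_sum fun i _ => ?_
    have h1 : absDown (fun i => (x i + y i) / 2) i = |x (σ i) + y (σ i)| / 2 := by
      simp [absDown, σ, abs_div]
    rw [h1]
    nlinarith [mul_le_mul_of_nonneg_left (abs_add_le (x (σ i)) (y (σ i))) (hpos i)]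
  rw [← Finset.sum_div, Finset.sum_add_distrib] at h
  linarith

/-! ### The two minimization problems -/

/-- `p` minimizes `x ↦ ½‖x - y‖² + κ_λ(x)`. -/
def IsProx {n : ℕ} (lam y p : Fin n → ℝ) : Prop :=
  ∀ x : Fin n → ℝ, (1 / 2) * ∑ i, (p i - y i) ^ 2 + kappa lam p ≤
    (1 / 2) * ∑ i, (x i - y i) ^ 2 + kappa lam x

/-- `u` minimizes `x ↦ ½‖x - w‖² + ⟨λ, x⟩` over the monotone nonnegative cone. -/
def IsConeProx {n : ℕ} (lam w u : Fin n → ℝ) : Prop :=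
  u ∈ monoCone n ∧ ∀ x ∈ monoCone n,
    (1 / 2) * ∑ i, (u i - w i) ^ 2 + ∑ i, lam i * u i ≤
      (1 / 2) * ∑ i, (x i - w i) ^ 2 + ∑ i, lam i * x i

theorem IsProx.unique {n : ℕ} {lam y p q : Fin n → ℝ} (hmono : Antitone lam)
    (hpos : ∀ i, 0 ≤ lam i) (hp : IsProx lam y p) (hq : IsProx lam y q) : p = q := by
  have h1 := hp fun i => (p i + q i) / 2
  have h2 := hq fun i => (p i + q i) / 2
  have h3 := kappa_midpoint_le hmono hpos p q
  have h4 : ∑ i, ((p i + q i) / 2 - y i) ^ 2 =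
      (∑ i, (p i - y i) ^ 2) / 2 + (∑ i, (q i - y i) ^ 2) / 2 - (∑ i, (p i - q i) ^ 2) / 4 := by
    simp only [Finset.sum_div, ← Finset.sum_add_distrib, ← Finset.sum_sub_distrib]
    exact Finset.sum_congr rfl fun i _ => by ring
  have h5 : ∑ i, (p i - q i) ^ 2 = 0 :=
    le_antisymm (by linarith) (Finset.sum_nonneg fun i _ => sq_nonneg _)
  funext i
  have h6 := (Finset.sum_eq_zero_iff_of_nonneg fun i _ => sq_nonneg (p i - q i)).1 h5 i
    (Finset.mem_univ i)
  nlinarith [pow_eq_zero_iff (two_ne_zero) |>.1 h6]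

/-- For sorted nonnegative data the proximal point lies in the cone. -/
theorem IsProx.isConeProx {n : ℕ} {lam w q : Fin n → ℝ} (hmono : Antitone lam)
    (hpos : ∀ i, 0 ≤ lam i) (hw : w ∈ monoCone n) (hq : IsProx lam w q) :
    IsConeProx lam w q := by
  have hs : IsProx lam w (absDown q) := by
    intro x
    refine le_trans ?_ (hq x)
    have h1 : kappa lam (absDown q) = kappa lam q := kappa_of_mem lam (absDown_mem_monoCone q)
    have h2 : ∑ i, w i * q i ≤ ∑ i, w i * absDown q i :=
      (Finset.sum_le_sum fun i _ => mul_le_mul_of_nonneg_left (le_abs_self _) (hw.2 i)).trans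
        (sum_mul_abs_perm_le_kappa hw.1 q 1)
    have h3 (v : Fin n → ℝ) : ∑ i, (v i - w i) ^ 2 =
        ∑ i, v i ^ 2 - 2 * ∑ i, w i * v i + ∑ i, w i ^ 2 := by
      simp only [Finset.mul_sum, ← Finset.sum_add_distrib, ← Finset.sum_sub_distrib]
      exact Finset.sum_congr rfl fun i _ => by ring
    rw [h1, h3, h3, sum_absDown_sq]
    linarith
  have hmem : q ∈ monoCone n := by
    rw [hq.unique hmono hpos hs]
    exact absDown_mem_monoCone q
  refine ⟨hmem, fun x hx => ?_⟩
  simpa only [kappa_of_mem lam hmem, kappa_of_mem lam hx] using hq x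

theorem nonneg_of_forall_quadratic_nonneg {a b : ℝ} (hb : 0 ≤ b)
    (h : ∀ t : ℝ, 0 ≤ t → t ≤ 1 → 0 ≤ t * a + t ^ 2 * b) : 0 ≤ a := by
  by_contra! ha
  have hba : 0 < b - a := by linarith
  have h1 := h (-a / (b - a)) (by apply div_nonneg <;> linarith)
    ((div_le_one hba).2 (by linarith))
  have h2 : -a / (b - a) * a + (-a / (b - a)) ^ 2 * b = a ^ 3 / (b - a) ^ 2 := by
    field_simp
    ring
  rw [h2] at h1
  have h3 : a ^ 3 / (b - a) ^ 2 < 0 :=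
    div_neg_of_neg_of_pos (by nlinarith [sq_pos_of_neg ha]) (by positivity)
  linarith

/-- Variational inequality for the projection onto the cone. -/
theorem IsConeProx.variational {n : ℕ} {lam w u : Fin n → ℝ} (hu : IsConeProx lam w u)
    {x : Fin n → ℝ} (hx : x ∈ monoCone n) :
    0 ≤ ∑ i, (u i - w i + lam i) * (x i - u i) := by
  refine nonneg_of_forall_quadratic_nonneg (b := (1 / 2) * ∑ i, (x i - u i) ^ 2)
    (by have := Finset.sum_nonneg fun i (_ : i ∈ Finset.univ) => sq_nonneg (x i - u i)
        linarith) fun t ht ht1 => ?_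
  have h := hu.2 (fun i => (1 - t) * u i + t * x i)
    (convex_monoCone n hu.1 hx (by linarith) ht (by ring))
  have e : (1 / 2) * ∑ i, ((1 - t) * u i + t * x i - w i) ^ 2 +
        ∑ i, lam i * ((1 - t) * u i + t * x i) =
      (1 / 2) * ∑ i, (u i - w i) ^ 2 + ∑ i, lam i * u i +
        (t * ∑ i, (u i - w i + lam i) * (x i - u i) +
          t ^ 2 * ((1 / 2) * ∑ i, (x i - u i) ^ 2)) := by
    simp only [Finset.mul_sum, ← Finset.sum_add_distrib]
    exact Finset.sum_congr rfl fun i _ => by ring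
  linarith

theorem IsConeProx.sum_sq_sub_le {n : ℕ} {lam w u w' u' : Fin n → ℝ}
    (hu : IsConeProx lam w u) (hu' : IsConeProx lam w' u') :
    ∑ i, (u' i - u i) ^ 2 ≤ ∑ i, (w' i - w i) ^ 2 := by
  have h1 := hu.variational hu'.1
  have h2 := hu'.variational hu.1
  have h3 : ∑ i, (u i - w i + lam i) * (u' i - u i) + ∑ i, (u' i - w' i + lam i) * (u i - u' i) +
      (1 / 2) * ∑ i, (u' i - u i - (w' i - w i)) ^ 2 =
      (1 / 2) * ∑ i, (w' i - w i) ^ 2 - (1 / 2) * ∑ i, (u' i - u i) ^ 2 := by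
    simp only [Finset.mul_sum, ← Finset.sum_add_distrib, ← Finset.sum_sub_distrib]
    exact Finset.sum_congr rfl fun i _ => by ring
  have h5 : (0 : ℝ) ≤ ∑ i, (u' i - u i - (w' i - w i)) ^ 2 :=
    Finset.sum_nonneg fun i _ => sq_nonneg _
  linarith

theorem IsConeProx.unique {n : ℕ} {lam w u u' : Fin n → ℝ}
    (hu : IsConeProx lam w u) (hu' : IsConeProx lam w u') : u' = u := by
  have h := hu.sum_sq_sub_le hu'
  simp only [sub_self, ne_eq, OfNat.ofNat_ne_zero, not_false_eq_true, zero_pow,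
    Finset.sum_const_zero] at h
  have h5 := le_antisymm h (Finset.sum_nonneg fun i _ => sq_nonneg (u' i - u i))
  funext i
  have h6 := (Finset.sum_eq_zero_iff_of_nonneg fun i _ => sq_nonneg (u' i - u i)).1 h5 i
    (Finset.mem_univ i)
  exact sub_eq_zero.1 (pow_eq_zero_iff two_ne_zero |>.1 h6)

/-! ### The matrix `B` and its multipliers -/

theorem Bmat_mulVec_of_lt {n : ℕ} (x : Fin n → ℝ) (i : Fin n) (h : (i : ℕ) + 1 < n) :
    (Bmat n).mulVec x i = x i - x ⟨i + 1, h⟩ := by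
  have e : ∀ j : Fin n, Bmat n i j * x j =
      (if j = i then x j else 0) - (if j = ⟨i + 1, h⟩ then x j else 0) := by
    intro j
    simp only [Bmat, Matrix.of_apply, Fin.ext_iff]
    split_ifs <;> first | omega | ring
  simp [Matrix.mulVec, dotProduct, e, Finset.sum_sub_distrib]

theorem Bmat_mulVec_of_not_lt {n : ℕ} (x : Fin n → ℝ) (i : Fin n) (h : ¬ (i : ℕ) + 1 < n) :
    (Bmat n).mulVec x i = x i := by
  have e : ∀ j : Fin n, Bmat n i j * x j = if j = i then x j else 0 := by
    intro j
    have := j.2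
    simp only [Bmat, Matrix.of_apply, Fin.ext_iff]
    split_ifs <;> first | omega | ring
  simp [Matrix.mulVec, dotProduct, e]

/-- The matrix of partial sums. -/
def partialSumMat (n : ℕ) : Matrix (Fin n) (Fin n) ℝ :=
  Matrix.of fun i j => if j ≤ i then 1 else 0

theorem partialSumMat_mulVec {n : ℕ} (x : Fin n → ℝ) (i : Fin n) :
    (partialSumMat n).mulVec x i = ∑ j, if j ≤ i then x j else 0 := by
  simp [partialSumMat, Matrix.mulVec, dotProduct]

theorem Bmat_mul_partialSumMat_transpose (n : ℕ) : Bmat n * (partialSumMat n)ᵀ = 1 := by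
  ext i k
  have e : (Bmat n * (partialSumMat n)ᵀ) i k =
      (Bmat n).mulVec (fun j => partialSumMat n k j) i := rfl
  rw [e]
  have := k.2
  by_cases h : (i : ℕ) + 1 < n
  · rw [Bmat_mulVec_of_lt _ _ h]
    simp only [partialSumMat, Matrix.of_apply, Matrix.one_apply, Fin.ext_iff, Fin.le_def]
    split_ifs <;> first | omega | norm_num
  · rw [Bmat_mulVec_of_not_lt _ _ h]
    simp only [partialSumMat, Matrix.of_apply, Matrix.one_apply, Fin.ext_iff, Fin.le_def]
    split_ifs <;> first | omega | norm_num

theorem partialSumMat_mul_Bmat_transpose (n : ℕ) : partialSumMat n * (Bmat n)ᵀ = 1 := by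
  have h := congrArg Matrix.transpose (Bmat_mul_partialSumMat_transpose n)
  simpa [Matrix.transpose_mul] using h

theorem Bmat_transpose_mul_partialSumMat (n : ℕ) : (Bmat n)ᵀ * partialSumMat n = 1 :=
  mul_eq_one_comm.1 (partialSumMat_mul_Bmat_transpose n)

/-- The multiplier `z` with `u - w + λ = Bᵀ z`. -/
def multiplier {n : ℕ} (lam w u : Fin n → ℝ) : Fin n → ℝ :=
  (partialSumMat n).mulVec (u - w + lam)

theorem IsConeProx.sum_indicator_mul_nonneg {n : ℕ} {lam w u : Fin n → ℝ}
    (hu : IsConeProx lam w u) (i : Fin n) (t : ℝ)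
    (hx : (fun j => u j + if j ≤ i then t else 0) ∈ monoCone n) :
    0 ≤ t * multiplier lam w u i := by
  have h := hu.variational hx
  rw [multiplier, partialSumMat_mulVec, Finset.mul_sum]
  refine h.trans_eq (Finset.sum_congr rfl fun j _ => ?_)
  split_ifs <;> simp [mul_comm]

theorem IsConeProx.multiplier_nonneg {n : ℕ} {lam w u : Fin n → ℝ}
    (hu : IsConeProx lam w u) (i : Fin n) : 0 ≤ multiplier lam w u i := by
  have h := hu.sum_indicator_mul_nonneg i 1 ⟨fun a b hab => ?_, fun j => ?_⟩
  · simpa using h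
  · have := hu.1.1 hab
    dsimp only
    split_ifs with h1 h2
    · linarith
    · exact absurd (hab.trans h1) h2
    · linarith
    · linarith
  · have := hu.1.2 j
    dsimp only
    split_ifs <;> linarith

theorem Bmat_mulVec_nonneg {n : ℕ} {u : Fin n → ℝ} (hu : u ∈ monoCone n) (i : Fin n) :
    0 ≤ (Bmat n).mulVec u i := by
  by_cases h : (i : ℕ) + 1 < n
  · rw [Bmat_mulVec_of_lt _ _ h]
    exact sub_nonneg.2 (hu.1 (Fin.le_def.2 (Nat.le_succ _)))
  · rw [Bmat_mulVec_of_not_lt _ _ h]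
    exact hu.2 i

/-- Decreasing the first `i` entries by `(Bu)_i` stays in the cone. -/
theorem sub_Bmat_mulVec_mem {n : ℕ} {u : Fin n → ℝ} (hu : u ∈ monoCone n) (i : Fin n) :
    (fun j => u j + if j ≤ i then -(Bmat n).mulVec u i else 0) ∈ monoCone n := by
  have h0 := Bmat_mulVec_nonneg hu i
  by_cases h : (i : ℕ) + 1 < n
  · have hB := Bmat_mulVec_of_lt u i h
    have key : ∀ a b : Fin n, a ≤ i → ¬ b ≤ i → u b ≤ u a - (Bmat n).mulVec u i := by
      intro a b ha hb
      have h1 : u b ≤ u ⟨i + 1, h⟩ := hu.1 (Fin.le_def.2 (by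
        have := not_le.1 hb
        exact Nat.succ_le_of_lt (Fin.lt_def.1 this)))
      have h2 : u i ≤ u a := hu.1 ha
      linarith
    refine ⟨fun a b hab => ?_, fun j => ?_⟩
    · have := hu.1 hab
      dsimp only
      split_ifs with h1 h2 h2
      · linarith
      · exact absurd (hab.trans h1) h2
      · linarith [key a b h2 h1]
      · linarith
    · dsimp only
      split_ifs with h1
      · have := key j ⟨i + 1, h⟩ h1 (by simp [Fin.le_def])
        linarith [hu.2 ⟨i + 1, h⟩]
      · linarith [hu.2 j]
  · have hB := Bmat_mulVec_of_not_lt u i h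
    have hi : ∀ j : Fin n, j ≤ i := fun j => Fin.le_def.2 (by omega)
    refine ⟨fun a b hab => ?_, fun j => ?_⟩
    · simpa [hi] using hu.1 hab
    · have := hu.1 (hi j)
      simp only [hi, if_true]
      linarith

/-- Complementary slackness. -/
theorem IsConeProx.multiplier_eq_zero {n : ℕ} {lam w u : Fin n → ℝ}
    (hu : IsConeProx lam w u) (i : Fin n) (hi : (Bmat n).mulVec u i ≠ 0) :
    multiplier lam w u i = 0 := by
  have h1 := hu.sum_indicator_mul_nonneg i _ (sub_Bmat_mulVec_mem hu.1 i)
  have h2 := hu.multiplier_nonneg i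
  have h3 := lt_of_le_of_ne (Bmat_mulVec_nonneg hu.1 i) hi.symm
  nlinarith

/-! ### The projection `P` -/

theorem Brows_transpose_mulVec {n : ℕ} (Γ : Finset (Fin n)) (z : Fin n → ℝ)
    (hz : ∀ i ∉ Γ, z i = 0) :
    (Brows Γ)ᵀ.mulVec (fun i => z i.1) = (Bmat n)ᵀ.mulVec z := by
  funext j
  simp only [Matrix.mulVec, dotProduct, Brows, Matrix.transpose_apply, Matrix.of_apply]
  rw [Finset.sum_coe_sort Γ fun i => Bmat n i j * z i]
  exact Finset.sum_subset (Finset.subset_univ Γ) fun i _ hi => by simp [hz i hi]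

theorem isUnit_det_Brows_mul_transpose {n : ℕ} (Γ : Finset (Fin n)) :
    IsUnit (Brows Γ * (Brows Γ)ᵀ).det := by
  have hinj : Function.Injective (Brows Γ).vecMul := by
    refine (injective_iff_map_eq_zero (Matrix.vecMulLinear (Brows Γ))).2 fun z hz => ?_
    classical
    set z' : Fin n → ℝ := fun i => if h : i ∈ Γ then z ⟨i, h⟩ else 0
    have h1 := Brows_transpose_mulVec Γ z' fun i hi => by simp [z', hi]
    have h2 : (fun i : {i // i ∈ Γ} => z' i.1) = z := by
      funext i
      simp [z']
    rw [h2, Matrix.mulVec_transpose] at h1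
    have h3 : (Bmat n)ᵀ.mulVec z' = 0 := by
      rw [← h1]
      exact hz
    have h4 : z' = 0 := by
      have := congrArg (partialSumMat n).mulVec h3
      simpa [Matrix.mulVec_mulVec, partialSumMat_mul_Bmat_transpose] using this
    rw [← h2, h4]
    rfl
  have h := Matrix.PosDef.mul_conjTranspose_self (Brows Γ) hinj
  rw [Matrix.conjTranspose_eq_transpose_of_trivial] at h
  exact h.det_pos.ne'.isUnit

theorem Pmat_mulVec_of_Brows_eq_zero {n : ℕ} (Γ : Finset (Fin n)) {v : Fin n → ℝ}
    (hv : ∀ i ∈ Γ, (Bmat n).mulVec v i = 0) : (Pmat Γ).mulVec v = v := by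
  have h : (Brows Γ).mulVec v = 0 := funext fun i => hv i.1 i.2
  rw [Pmat, Matrix.sub_mulVec, ← Matrix.mulVec_mulVec, h]
  simp

theorem Pmat_mulVec_Bmat_transpose {n : ℕ} (Γ : Finset (Fin n)) {z : Fin n → ℝ}
    (hz : ∀ i ∉ Γ, z i = 0) : (Pmat Γ).mulVec ((Bmat n)ᵀ.mulVec z) = 0 := by
  have h : Pmat Γ * (Brows Γ)ᵀ = 0 := by
    rw [Pmat, Matrix.sub_mul, Matrix.mul_assoc, Matrix.mul_assoc,
      Matrix.nonsing_inv_mul _ (isUnit_det_Brows_mul_transpose Γ)]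
    simp
  rw [← Brows_transpose_mulVec Γ z hz, Matrix.mulVec_mulVec, h, Matrix.zero_mulVec]

/-- If the active set at `u'` and the multiplier support of `u` are compatible, then `u' - u` is
the projection of the difference of the data. -/
theorem IsConeProx.sub_eq_Pmat_mulVec {n : ℕ} {lam w u w' u' : Fin n → ℝ}
    (hu' : IsConeProx lam w' u')
    (hB : ∀ i, (Bmat n).mulVec u i ≠ 0 → (Bmat n).mulVec u' i ≠ 0)
    (hz : ∀ i, multiplier lam w u i ≠ 0 → multiplier lam w' u' i ≠ 0) :
    u' - u = (Pmat (Finset.univ.filter fun i => (Bmat n).mulVec u' i = 0)).mulVec (w' - w) := by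
  set Γ := Finset.univ.filter fun i => (Bmat n).mulVec u' i = 0
  have h1 : (Pmat Γ).mulVec (u' - u) = u' - u := by
    refine Pmat_mulVec_of_Brows_eq_zero Γ fun i hi => ?_
    have hi' : (Bmat n).mulVec u' i = 0 := (Finset.mem_filter.1 hi).2
    have hi0 : (Bmat n).mulVec u i = 0 := by
      by_contra h
      exact hB i h hi'
    rw [Matrix.mulVec_sub, Pi.sub_apply, hi', hi0, sub_zero]
  have h2 : (Pmat Γ).mulVec
      ((Bmat n)ᵀ.mulVec (multiplier lam w' u' - multiplier lam w u)) = 0 := by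
    refine Pmat_mulVec_Bmat_transpose Γ fun i hi => ?_
    have hi' : (Bmat n).mulVec u' i ≠ 0 := fun h => hi (by simp [Γ, h])
    have hz' := hu'.multiplier_eq_zero i hi'
    have hz0 : multiplier lam w u i = 0 := by
      by_contra h
      exact hz i h hz'
    rw [Pi.sub_apply, hz', hz0, sub_zero]
  have h3 : (Bmat n)ᵀ.mulVec (multiplier lam w' u' - multiplier lam w u) =
      (u' - u) - (w' - w) := by
    rw [multiplier, multiplier, ← Matrix.mulVec_sub, Matrix.mulVec_mulVec,
      Bmat_transpose_mul_partialSumMat, Matrix.one_mulVec]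
    abel
  rw [h3, Matrix.mulVec_sub, h1, sub_eq_zero] at h2
  exact h2

open Topology in
theorem eventually_active_compatible {n : ℕ} (lam w u : Fin n → ℝ) :
    ∀ᶠ a : (Fin n → ℝ) × (Fin n → ℝ) in 𝓝 (w, u),
      (∀ i, (Bmat n).mulVec u i ≠ 0 → (Bmat n).mulVec a.2 i ≠ 0) ∧
        ∀ i, multiplier lam w u i ≠ 0 → multiplier lam a.1 a.2 i ≠ 0 := by
  have hB : Continuous fun a : (Fin n → ℝ) × (Fin n → ℝ) => (Bmat n).mulVec a.2 := by
    fun_prop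
  have hz : Continuous fun a : (Fin n → ℝ) × (Fin n → ℝ) => multiplier lam a.1 a.2 := by
    unfold multiplier
    fun_prop
  refine Filter.Eventually.and (Filter.eventually_all.2 fun i => ?_)
    (Filter.eventually_all.2 fun i => ?_)
  · refine Filter.eventually_imp_distrib_left.2 fun h => ?_
    exact ((continuous_apply i).comp hB).continuousAt.eventually_ne h
  · refine Filter.eventually_imp_distrib_left.2 fun h => ?_
    exact ((continuous_apply i).comp hz).continuousAt.eventually_ne h

/-! ### Signed permutations -/

theorem IsSignedPerm.exists_perm {n : ℕ} {π : Matrix (Fin n) (Fin n) ℝ} (h : IsSignedPerm π) :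
    ∃ (σ : Equiv.Perm (Fin n)) (ε : Fin n → ℝ), (∀ i, |ε i| = 1) ∧
      ∀ i j, π i j = if j = σ i then ε i else 0 := by
  obtain ⟨hrow, hcol, hval⟩ := h
  choose f hf hfu using hrow
  have hinj : Function.Injective f := fun a b hab =>
    (hcol (f a)).unique (hf a) (by simpa [hab] using hf b)
  refine ⟨Equiv.ofBijective f (Finite.injective_iff_bijective.1 hinj), fun i => π i (f i),
    fun i => ?_, fun i j => ?_⟩
  · rcases hval i (f i) with h | h | h
    · exact absurd h (hf i)
    · simp [h]
    · simp [h]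
  · simp only [Equiv.ofBijective_apply]
    split_ifs with hj
    · rw [hj]
    · by_contra h
      exact hj (hfu i j h)

theorem mulVec_signedPerm {n : ℕ} {π : Matrix (Fin n) (Fin n) ℝ} {σ : Equiv.Perm (Fin n)}
    {ε : Fin n → ℝ} (hπ : ∀ i j, π i j = if j = σ i then ε i else 0) (x : Fin n → ℝ) (i : Fin n) :
    π.mulVec x i = ε i * x (σ i) := by
  simp [Matrix.mulVec, dotProduct, hπ]

theorem IsSignedPerm.transpose_mul_self {n : ℕ} {π : Matrix (Fin n) (Fin n) ℝ}
    (h : IsSignedPerm π) : πᵀ * π = 1 := by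
  obtain ⟨σ, ε, hε, hπ⟩ := h.exists_perm
  refine mul_eq_one_comm.1 ?_
  ext i k
  simp only [Matrix.mul_apply, Matrix.transpose_apply, hπ, Matrix.one_apply]
  by_cases hik : i = k
  · subst hik
    have h1 : ε i * ε i = 1 := by rw [← abs_mul_abs_self, hε i, one_mul]
    simp [h1]
  · simp [hik, Ne.symm hik]

theorem IsSignedPerm.mul_transpose_self {n : ℕ} {π : Matrix (Fin n) (Fin n) ℝ}
    (h : IsSignedPerm π) : π * πᵀ = 1 := mul_eq_one_comm.1 h.transpose_mul_self

theorem IsSignedPerm.sum_sq_mulVec_sub {n : ℕ} {π : Matrix (Fin n) (Fin n) ℝ}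
    (h : IsSignedPerm π) (x y : Fin n → ℝ) :
    ∑ i, (π.mulVec x i - π.mulVec y i) ^ 2 = ∑ i, (x i - y i) ^ 2 := by
  obtain ⟨σ, ε, hε, hπ⟩ := h.exists_perm
  rw [← Equiv.sum_comp σ fun i => (x i - y i) ^ 2]
  refine Finset.sum_congr rfl fun i _ => ?_
  rw [mulVec_signedPerm hπ, mulVec_signedPerm hπ, ← mul_sub, mul_pow, ← sq_abs (ε i), hε i,
    one_pow, one_mul]

theorem IsSignedPerm.absDown_mulVec {n : ℕ} {π : Matrix (Fin n) (Fin n) ℝ}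
    (h : IsSignedPerm π) (x : Fin n → ℝ) : absDown (π.mulVec x) = absDown x := by
  obtain ⟨σ, ε, hε, hπ⟩ := h.exists_perm
  set τ := Tuple.sort fun k => -|π.mulVec x k|
  have e : absDown (π.mulVec x) = fun i => |x ((τ.trans σ) i)| := by
    funext i
    change |π.mulVec x (τ i)| = _
    rw [mulVec_signedPerm hπ, abs_mul, hε, one_mul]
    rfl
  rw [e]
  refine (absDown_eq_of_antitone x (τ.trans σ) ?_).symm
  rw [← e]
  exact (absDown_mem_monoCone _).1

theorem IsSignedPerm.isProx_mulVec {n : ℕ} {π : Matrix (Fin n) (Fin n) ℝ}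
    (h : IsSignedPerm π) {lam y p : Fin n → ℝ} (hp : IsProx lam y p) :
    IsProx lam (π.mulVec y) (π.mulVec p) := by
  intro x
  have hx : π.mulVec (πᵀ.mulVec x) = x := by
    rw [Matrix.mulVec_mulVec, h.mul_transpose_self, Matrix.one_mulVec]
  have hk (v : Fin n → ℝ) : kappa lam (π.mulVec v) = kappa lam v := by
    rw [kappa, kappa, h.absDown_mulVec]
  have := hp (πᵀ.mulVec x)
  rw [← hx, h.sum_sq_mulVec_sub, h.sum_sq_mulVec_sub, hk, hk]
  exact this

theorem finite_setOf_isSignedPerm (n : ℕ) :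
    {π : Matrix (Fin n) (Fin n) ℝ | IsSignedPerm π}.Finite := by
  have hf : ({0, 1, -1} : Set ℝ).Finite := by simp
  have h : (Set.univ.pi fun _ : Fin n => Set.univ.pi fun _ : Fin n =>
      ({0, 1, -1} : Set ℝ)).Finite := Set.Finite.pi fun _ => Set.Finite.pi fun _ => hf
  refine h.subset fun π hπ => ?_
  intro i _ j _
  simpa using hπ.2.2 i j

open Topology in
/-- A signed permutation sorting a point close to `y` also sorts `y`. -/
theorem eventually_mulVec_mem_monoCone {n : ℕ} (y : Fin n → ℝ) :
    ∀ᶠ y' in 𝓝 y, ∀ π : Matrix (Fin n) (Fin n) ℝ, IsSignedPerm π →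
      π.mulVec y' ∈ monoCone n → π.mulVec y ∈ monoCone n := by
  refine ((finite_setOf_isSignedPerm n).eventually_all).2 fun π _ => ?_
  by_cases h : π.mulVec y ∈ monoCone n
  · exact Filter.Eventually.of_forall fun _ _ => h
  · have hc : Continuous fun y' : Fin n → ℝ => π.mulVec y' := by fun_prop
    have := hc.continuousAt.eventually ((isClosed_monoCone n).isOpen_compl.mem_nhds h)
    exact this.mono fun y' h1 h2 => absurd h2 h1

theorem dist_lt_of_sum_sq_lt {n : ℕ} {x y : Fin n → ℝ} {δ : ℝ} (hδ : 0 < δ)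
    (h : ∑ i, (x i - y i) ^ 2 < δ ^ 2) : dist x y < δ := by
  refine (dist_pi_lt_iff hδ).2 fun i => ?_
  rw [Real.dist_eq]
  refine abs_lt_of_sq_lt_sq ?_ hδ.le
  exact (Finset.single_le_sum (fun i _ => sq_nonneg (x i - y i)) (Finset.mem_univ i)).trans_lt h

theorem sum_sq_lt_of_eucNorm_lt {n : ℕ} {x y : Fin n → ℝ} {δ : ℝ}
    (h : eucNorm (x - y) < δ) : ∑ i, (x i - y i) ^ 2 < δ ^ 2 :=
  Real.lt_sq_of_sqrt_lt h

/-- Local affine expansion of the proximal mapping of `κ_λ`: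
`Prox(y') - Prox(y) = πᵀ P π (y' - y)` for all `y'` near `y`, where
`π` sorts `|y'|`, `u = x_λ(πy')`, `Γ = {i : (Bu)_i = 0}` and
`P = Iₙ - B_Γᵀ (B_Γ B_Γᵀ)⁻¹ B_Γ` (equal to `Iₙ` when `Γ = ∅`). -/
theorem stmt14 {n : ℕ} (lam : Fin n → ℝ) (hmono : Antitone lam) (hpos : ∀ i, 0 ≤ lam i)
    (y : Fin n → ℝ) :
    ∃ δ > 0, ∀ y' : Fin n → ℝ, eucNorm (y' - y) < δ →
      ∀ π : Matrix (Fin n) (Fin n) ℝ, IsSignedPerm π → π.mulVec y' = absDown y' →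
      ∀ u : Fin n → ℝ, (Antitone u ∧ ∀ i, 0 ≤ u i) →
        (∀ x : Fin n → ℝ, (Antitone x ∧ ∀ i, 0 ≤ x i) →
          (1 / 2) * ∑ i, (u i - π.mulVec y' i) ^ 2 + ∑ i, lam i * u i ≤
            (1 / 2) * ∑ i, (x i - π.mulVec y' i) ^ 2 + ∑ i, lam i * x i) →
      ∀ p : Fin n → ℝ,
        (∀ x : Fin n → ℝ,
          (1 / 2) * ∑ i, (p i - y i) ^ 2 + kappa lam p ≤
            (1 / 2) * ∑ i, (x i - y i) ^ 2 + kappa lam x) →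
      ∀ p' : Fin n → ℝ,
        (∀ x : Fin n → ℝ,
          (1 / 2) * ∑ i, (p' i - y' i) ^ 2 + kappa lam p' ≤
            (1 / 2) * ∑ i, (x i - y' i) ^ 2 + kappa lam x) →
      p' - p =
        (πᵀ * Pmat (Finset.univ.filter fun i => (Bmat n).mulVec u i = 0) * π).mulVec (y' - y) := by
  have key : ∃ ε > 0, ∀ u₀, IsConeProx lam (absDown y) u₀ → ∀ w' u' : Fin n → ℝ,
      dist w' (absDown y) < ε → dist u' u₀ < ε →
      (∀ i, (Bmat n).mulVec u₀ i ≠ 0 → (Bmat n).mulVec u' i ≠ 0) ∧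
        ∀ i, multiplier lam (absDown y) u₀ i ≠ 0 → multiplier lam w' u' i ≠ 0 := by
    by_cases hex : ∃ u₀, IsConeProx lam (absDown y) u₀
    · obtain ⟨u₀, hu₀⟩ := hex
      obtain ⟨ε, hε, h⟩ :=
        Metric.eventually_nhds_iff.1 (eventually_active_compatible lam (absDown y) u₀)
      refine ⟨ε, hε, fun u₁ hu₁ w' u' hw hu => ?_⟩
      obtain rfl := hu₀.unique hu₁
      exact h (y := (w', u')) (by rw [Prod.dist_eq]; exact max_lt hw hu)
    · exact ⟨1, one_pos, fun u₀ hu₀ => absurd ⟨u₀, hu₀⟩ hex⟩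
  obtain ⟨ε, hε, key⟩ := key
  obtain ⟨η, hη, hsort⟩ := Metric.eventually_nhds_iff.1 (eventually_mulVec_mem_monoCone y)
  refine ⟨min ε η, lt_min hε hη, ?_⟩
  intro y' hy' π hπ hπy' u hu humin p hp p' hp'
  have hw' : π.mulVec y' ∈ monoCone n := hπy' ▸ absDown_mem_monoCone y'
  have hw : π.mulVec y ∈ monoCone n := hsort (dist_lt_of_sum_sq_lt hη
    (sum_sq_lt_of_eucNorm_lt (hy'.trans_le (min_le_right _ _)))) π hπ hw'
  have hπy : absDown y = π.mulVec y := by rw [← hπ.absDown_mulVec, absDown_of_mem hw]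
  have hq : IsConeProx lam (π.mulVec y) (π.mulVec p) :=
    (hπ.isProx_mulVec hp).isConeProx hmono hpos hw
  have hq' : IsConeProx lam (π.mulVec y') (π.mulVec p') :=
    (hπ.isProx_mulVec hp').isConeProx hmono hpos hw'
  obtain rfl : π.mulVec p' = u := IsConeProx.unique ⟨hu, humin⟩ hq'
  have hd : ∑ i, (π.mulVec y' i - π.mulVec y i) ^ 2 < ε ^ 2 := by
    rw [hπ.sum_sq_mulVec_sub]
    exact sum_sq_lt_of_eucNorm_lt (hy'.trans_le (min_le_left _ _))
  rw [hπy] at key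
  obtain ⟨hB, hz⟩ := key _ hq (π.mulVec y') (π.mulVec p') (dist_lt_of_sum_sq_lt hε hd)
    (dist_lt_of_sum_sq_lt hε ((hq.sum_sq_sub_le hq').trans_lt hd))
  have h := hq'.sub_eq_Pmat_mulVec hB hz
  rw [← Matrix.mulVec_sub, ← Matrix.mulVec_sub] at h
  rw [← Matrix.mulVec_mulVec, ← Matrix.mulVec_mulVec, ← h, Matrix.mulVec_mulVec,
    hπ.transpose_mul_self, Matrix.one_mulVec]
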